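/- arXiv:2409.17305 — 2 statements merged into one kernel-verified Lean document; each statement's English description precedes it below -/
import Mathlib

section
/- Let η, ℓ ∈ ℝ with ℓ ≠ −1, η ≠ 0, and 2ℓ+2 not a nonpositive integer. Then φ_{ℓ,η} and φ_{ℓ+1,η} have no common real zero: there is no x ∈ ℝ, x ≠ 0, with φ_{ℓ,η}(x) = 0 and φ_{ℓ+1,η}(x) = 0 (and neither function vanishes at 0, where both equal 1). -/
noncomputable def coulombCoeff (l η : ℝ) : ℕ → ℝ
  | 0 => 1
  | 1 => η / (l + 1)
  | (k + 2) =>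
      (2 * η * coulombCoeff l η (k + 1) - coulombCoeff l η k) /
        (((k : ℝ) + 2) * (((k : ℝ) + 2) + 2 * l + 1))

/-- The function φ_{ℓ,η}, real-valued on ℝ. -/
noncomputable def coulombPhi (l η x : ℝ) : ℝ := ∑' k : ℕ, coulombCoeff l η k * x ^ k

/-- The sum of the power series with coefficients `c`. -/
noncomputable def powerSum (c : ℕ → ℝ) (x : ℝ) : ℝ := ∑' k : ℕ, c k * x ^ k

/-- The coefficients of the termwise derivative of a power series. -/
def derivCoeff (c : ℕ → ℝ) (k : ℕ) : ℝ := (k + 1) * c (k + 1)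

theorem powerSum_zero (c : ℕ → ℝ) : powerSum c 0 = c 0 := by
  unfold powerSum
  rw [tsum_eq_single 0]
  · simp
  · intro k hk
    simp [hk]

theorem summable_derivCoeff {c : ℕ → ℝ} (hc : ∀ x : ℝ, Summable fun k => c k * x ^ k) (x : ℝ) :
    Summable fun k => derivCoeff c k * x ^ k := by
  have h := ((summable_nat_add_iff 1).2 (hc (2 * (|x| + 1)))).abs
  refine Summable.of_norm_bounded h fun k => ?_
  have h2 : ((k : ℝ) + 1) ≤ 2 ^ (k + 1) := by
    exact_mod_cast (Nat.lt_two_pow_self (n := k + 1)).le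
  have hx : |x| ^ k ≤ (|x| + 1) ^ (k + 1) :=
    calc |x| ^ k ≤ (|x| + 1) ^ k := by gcongr; linarith
      _ ≤ (|x| + 1) ^ (k + 1) :=
        pow_le_pow_right₀ (by linarith [abs_nonneg x]) (Nat.le_succ k)
  have hk : |((k : ℝ) + 1)| = k + 1 := abs_of_nonneg (by positivity)
  have hr : |2 * (|x| + 1)| = 2 * (|x| + 1) := abs_of_nonneg (by positivity)
  rw [Real.norm_eq_abs, derivCoeff, abs_mul, abs_mul, abs_mul, abs_pow, abs_pow, hk, hr, mul_pow]
  calc ((k : ℝ) + 1) * |c (k + 1)| * |x| ^ k = |c (k + 1)| * (((k : ℝ) + 1) * |x| ^ k) := by ring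
    _ ≤ |c (k + 1)| * (2 ^ (k + 1) * (|x| + 1) ^ (k + 1)) := by gcongr

theorem hasDerivAt_powerSum {c : ℕ → ℝ} (hc : ∀ x : ℝ, Summable fun k => c k * x ^ k) (x : ℝ) :
    HasDerivAt (powerSum c) (powerSum (derivCoeff c) x) x := by
  have hu : Summable fun k : ℕ => |c k| * (k * (|x| + 1) ^ (k - 1)) := by
    refine (summable_nat_add_iff 1).1 ?_
    refine (summable_derivCoeff hc (|x| + 1)).abs.congr fun k => ?_
    have hk : |((k : ℝ) + 1)| = k + 1 := abs_of_nonneg (by positivity)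
    have hr : |(|x| + 1)| = |x| + 1 := abs_of_nonneg (by positivity)
    rw [derivCoeff, abs_mul, abs_mul, abs_pow, hk, hr]
    rw [Nat.add_sub_cancel]
    push_cast
    ring
  have hbound : ∀ (k : ℕ) (y : ℝ), y ∈ Metric.ball (0 : ℝ) (|x| + 1) →
      ‖c k * (k * y ^ (k - 1))‖ ≤ |c k| * (k * (|x| + 1) ^ (k - 1)) := by
    intro k y hy
    have hy' : |y| ≤ |x| + 1 := by
      rw [mem_ball_zero_iff, Real.norm_eq_abs] at hy
      exact hy.le
    rw [Real.norm_eq_abs, abs_mul, abs_mul, abs_pow, Nat.abs_cast]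
    gcongr
  have hx : x ∈ Metric.ball (0 : ℝ) (|x| + 1) := by
    rw [mem_ball_zero_iff, Real.norm_eq_abs]
    linarith
  have h := hasDerivAt_tsum_of_isPreconnected hu Metric.isOpen_ball
    (convex_ball (0 : ℝ) (|x| + 1)).isPreconnected
    (fun k y _ => (hasDerivAt_pow k y).const_mul (c k)) hbound hx (hc x) hx
  have hs : Summable fun k : ℕ => c k * (k * x ^ (k - 1)) :=
    Summable.of_norm_bounded hu fun k => hbound k x hx
  refine h.congr_deriv ?_
  rw [hs.tsum_eq_zero_add]
  simp only [powerSum, derivCoeff, Nat.cast_zero, zero_mul, mul_zero, zero_add, Nat.cast_add,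
    Nat.cast_one, Nat.add_sub_cancel]
  exact tsum_congr fun k => by ring

theorem mul_powerSum {c : ℕ → ℝ} (hc : ∀ x : ℝ, Summable fun k => c k * x ^ k) (x : ℝ) :
    HasSum (fun k => c k * x ^ (k + 1)) (x * powerSum c x) := by
  have h := (hc x).hasSum.mul_left x
  exact h.congr_fun fun k => by ring

/-- A solution of `t f'' + a f' + (b t + d) f = 0` on `[0, 1]` that vanishes to second order at `1`
vanishes at the singular point `0`. -/
theorem eq_zero_of_singular_ode {f g h : ℝ → ℝ} {a b d : ℝ}
    (hf : ∀ t, HasDerivAt f (g t) t) (hg : ∀ t, HasDerivAt g (h t) t)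
    (hode : ∀ t, t * h t + a * g t + (b * t + d) * f t = 0)
    (hf1 : f 1 = 0) (hg1 : g 1 = 0) : f 0 = 0 := by
  obtain ⟨N, hN⟩ := exists_nat_ge (2 * (|a| + |b| + |d|))
  set E : ℝ → ℝ := fun t => f t ^ 2 + g t ^ 2 with hE
  have hder : ∀ t, HasDerivAt (fun t => t ^ (N + 1) * E t)
      (t ^ N * ((N + 1) * E t + t * (2 * f t * g t + 2 * g t * h t))) t := by
    intro t
    have h1 := (hasDerivAt_pow (N + 1) t).mul (((hf t).pow 2).add ((hg t).pow 2))
    refine h1.congr_deriv ?_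
    simp only [hE, Nat.add_sub_cancel]
    push_cast
    simp
    ring
  have hmono : MonotoneOn (fun t => t ^ (N + 1) * E t) (Set.Icc 0 1) := by
    refine monotoneOn_of_deriv_nonneg (convex_Icc 0 1)
      (fun t _ => (hder t).continuousAt.continuousWithinAt)
      (fun t _ => (hder t).differentiableAt.differentiableWithinAt) fun t ht => ?_
    rw [interior_Icc] at ht
    rw [(hder t).deriv]
    refine mul_nonneg (pow_nonneg ht.1.le N) ?_
    have hEt : E t = f t ^ 2 + g t ^ 2 := rfl
    have hE0 : 0 ≤ E t := by positivity
    have hfg : |2 * (f t * g t)| ≤ E t := by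
      rw [abs_le, hEt]
      constructor <;> nlinarith [sq_nonneg (f t + g t), sq_nonneg (f t - g t)]
    have hgE : g t ^ 2 ≤ E t := by rw [hEt]; nlinarith [sq_nonneg (f t)]
    have h1 : -E t ≤ t * (2 * (f t * g t)) := by
      nlinarith [(abs_le.1 hfg).1, ht.1, ht.2]
    have h2 : a * g t ^ 2 ≤ |a| * E t :=
      mul_le_mul (le_abs_self a) hgE (sq_nonneg _) (abs_nonneg a)
    have h3 : (b * t + d) * (2 * (f t * g t)) ≤ (|b| + |d|) * E t := by
      refine (le_abs_self _).trans ?_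
      rw [abs_mul]
      refine mul_le_mul ?_ hfg (abs_nonneg _) (by positivity)
      refine (abs_add_le _ _).trans ?_
      rw [abs_mul, abs_of_pos ht.1]
      nlinarith [abs_nonneg b, ht.2]
    have h4 : t * (2 * g t * h t) = -2 * (a * g t ^ 2) - (b * t + d) * (2 * (f t * g t)) := by
      linear_combination 2 * g t * hode t
    have h5 : 2 * (|a| + |b| + |d|) * E t ≤ N * E t := mul_le_mul_of_nonneg_right hN hE0
    have h6 : 0 ≤ (|b| + |d|) * E t := by positivity
    nlinarith
  have hzero : ∀ t ∈ Set.Ioo (0 : ℝ) 1, f t = 0 := by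
    intro t ht
    have h1 := hmono ⟨ht.1.le, ht.2.le⟩ (Set.right_mem_Icc.2 zero_le_one) ht.2.le
    simp only [hE, hf1, hg1] at h1
    have hp : 0 < t ^ (N + 1) := pow_pos ht.1 _
    have h2 : f t ^ 2 + g t ^ 2 ≤ 0 := by
      by_contra! hpos
      have := mul_pos hp hpos
      norm_num at h1
      linarith
    nlinarith [sq_nonneg (f t), sq_nonneg (g t)]
  have hcont : Continuous f := continuous_iff_continuousAt.2 fun t => (hf t).continuousAt
  have hclosed : IsClosed {t | f t = 0} := isClosed_eq hcont continuous_const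
  have hsub := hclosed.closure_subset_iff.2 hzero
  rw [closure_Ioo zero_ne_one] at hsub
  exact hsub (Set.left_mem_Icc.2 zero_le_one)

theorem coulombCoeff_denom_ne_zero {l : ℝ} (hl : ∀ n : ℕ, 2 * l + 2 ≠ -(n : ℝ)) (k : ℕ) :
    ((k : ℝ) + 2) + 2 * l + 1 ≠ 0 := by
  intro h
  apply hl (k + 1)
  push_cast
  linarith

theorem coulombCoeff_recurrence {l : ℝ} (hl : ∀ n : ℕ, 2 * l + 2 ≠ -(n : ℝ)) (η : ℝ) (k : ℕ) :
    ((k : ℝ) + 2) * (((k : ℝ) + 2) + 2 * l + 1) * coulombCoeff l η (k + 2) =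
      2 * η * coulombCoeff l η (k + 1) - coulombCoeff l η k := by
  have h1 := coulombCoeff_denom_ne_zero hl k
  have h2 : (k : ℝ) + 2 ≠ 0 := by positivity
  rw [coulombCoeff]
  field_simp

theorem exists_abs_coulombCoeff_mul_pow_le (l η : ℝ) {R : ℝ} (hR : 0 ≤ R) :
    ∃ C, ∀ k, |coulombCoeff l η k| * R ^ k ≤ C := by
  obtain ⟨K, hK⟩ := exists_nat_ge (2 * |η| * R + R ^ 2 + 2 * |l|)
  set B : ℕ → ℝ := fun k => |coulombCoeff l η k| * R ^ k with hB
  have hB0 : ∀ k, 0 ≤ B k := fun k => by positivity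
  refine ⟨∑ j ∈ Finset.range (K + 2), B j, fun k => ?_⟩
  change B k ≤ _
  induction k using Nat.strong_induction_on with
  | _ k ih =>
    rcases lt_or_ge k (K + 2) with hk | hk
    · exact Finset.single_le_sum (fun j _ => hB0 j) (Finset.mem_range.2 hk)
    · obtain ⟨m, rfl⟩ : ∃ m, k = m + 2 := ⟨k - 2, by omega⟩
      have hm : (K : ℝ) ≤ m := by exact_mod_cast (by omega : K ≤ m)
      set C := ∑ j ∈ Finset.range (K + 2), B j
      have hC : 0 ≤ C := Finset.sum_nonneg fun j _ => hB0 j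
      have i1 := ih (m + 1) (by omega)
      have i0 := ih m (by omega)
      set D : ℝ := ((m : ℝ) + 2) * (((m : ℝ) + 2) + 2 * l + 1)
      have hRη : 0 ≤ 2 * |η| * R := by positivity
      have hD : 2 * |η| * R + R ^ 2 + 1 ≤ D := by
        have hl : -(2 * |l|) ≤ 2 * l := by linarith [neg_abs_le l]
        have h1 : 2 * |η| * R + R ^ 2 ≤ m + 2 := by linarith [abs_nonneg l]
        have h2 : 2 * |η| * R + R ^ 2 + 3 ≤ ((m : ℝ) + 2) + 2 * l + 1 := by linarith
        have h3 : 0 ≤ 2 * |η| * R + R ^ 2 := by positivity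
        have h4 : (2 : ℝ) * (2 * |η| * R + R ^ 2 + 3) ≤ D :=
          mul_le_mul (by linarith) h2 (by positivity) (by positivity)
        linarith
      have hDpos : 0 < D := by nlinarith [sq_nonneg R]
      have hrec : D * B (m + 2) ≤ 2 * |η| * R * B (m + 1) + R ^ 2 * B m := by
        have h1 : D * |coulombCoeff l η (m + 2)| =
            |2 * η * coulombCoeff l η (m + 1) - coulombCoeff l η m| := by
          rw [coulombCoeff, abs_div, abs_of_pos hDpos]
          field_simp
        have h2 := abs_sub (2 * η * coulombCoeff l η (m + 1)) (coulombCoeff l η m)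
        rw [abs_mul, abs_mul, abs_two, ← h1] at h2
        have h3 := mul_le_mul_of_nonneg_right h2 (pow_nonneg hR (m + 2))
        simp only [hB]
        calc _ = _ := by ring
          _ ≤ _ := h3
          _ = _ := by ring
      have h1 : 2 * |η| * R * B (m + 1) ≤ 2 * |η| * R * C := by gcongr
      have h0 : R ^ 2 * B m ≤ R ^ 2 * C := by gcongr
      have h5 : (2 * |η| * R + R ^ 2 + 1) * C ≤ D * C := by gcongr
      refine le_of_mul_le_mul_left ?_ hDpos
      linarith

theorem summable_coulombCoeff (l η x : ℝ) : Summable fun k => coulombCoeff l η k * x ^ k := by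
  obtain ⟨C, hC⟩ := exists_abs_coulombCoeff_mul_pow_le l η (R := 2 * |x|) (by positivity)
  refine Summable.of_norm_bounded (summable_geometric_two.mul_left C) fun k => ?_
  have h := hC k
  rw [mul_pow] at h
  rw [Real.norm_eq_abs, abs_mul, abs_pow, one_div, inv_pow, ← div_eq_mul_inv,
    le_div_iff₀ (by positivity)]
  linarith

theorem coulombCoeff_contiguous {l : ℝ} (hl1 : l ≠ -1) (hl : ∀ n : ℕ, 2 * l + 2 ≠ -(n : ℝ))
    (η : ℝ) (k : ℕ) :
    ((k : ℝ) + 2) * coulombCoeff l η (k + 2) = η / (l + 1) * coulombCoeff l η (k + 1) -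
      ((l + 1) ^ 2 + η ^ 2) / ((l + 1) ^ 2 * (2 * l + 3)) * coulombCoeff (l + 1) η k := by
  have hl' : ∀ n : ℕ, 2 * (l + 1) + 2 ≠ -(n : ℝ) := by
    intro n hn
    apply hl (n + 2)
    push_cast
    linarith
  have h1 : l + 1 ≠ 0 := fun h => hl1 (by linarith)
  have h3 : 2 * l + 3 ≠ 0 := fun h => hl 1 (by push_cast; linarith)
  have h4 : 2 * l + 4 ≠ 0 := fun h => hl 2 (by push_cast; linarith)
  have h2 : l + 1 + 1 ≠ 0 := fun h => h4 (by linarith)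
  set α := η / (l + 1) with hα
  have hαη : α * (l + 1) = η := div_mul_cancel₀ _ h1
  set c := ((l + 1) ^ 2 + η ^ 2) / ((l + 1) ^ 2 * (2 * l + 3)) with hcdef
  have hc : c * (2 * l + 3) = 1 + α ^ 2 := by
    rw [hcdef, hα, ← div_div, div_mul_cancel₀ _ h3]
    field_simp
  have a0 : coulombCoeff l η 0 = 1 := by rw [coulombCoeff]
  have a1 : coulombCoeff l η 1 = α := by rw [coulombCoeff]
  have b0 : coulombCoeff (l + 1) η 0 = 1 := by rw [coulombCoeff]
  have b1 : coulombCoeff (l + 1) η 1 * (l + 2) = η := by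
    rw [coulombCoeff]
    field_simp
    ring
  have r0 : 2 * (2 * l + 3) * coulombCoeff l η 2 = 2 * η * α - 1 := by
    have h := coulombCoeff_recurrence hl η 0
    simp only [zero_add, a0, a1, Nat.cast_zero] at h
    linear_combination h
  have r1 : 6 * (l + 2) * coulombCoeff l η 3 = 2 * η * coulombCoeff l η 2 - α := by
    have h := coulombCoeff_recurrence hl η 1
    simp only [Nat.reduceAdd, a1, Nat.cast_one] at h
    linear_combination h
  induction k using Nat.twoStepInduction with
  | zero =>
    apply mul_right_cancel₀ h3
    simp only [zero_add, a1, b0, Nat.cast_zero]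
    linear_combination r0 + hc - 2 * α * hαη
  | one =>
    have h4' : l + 2 ≠ 0 := fun h => h4 (by linarith)
    apply mul_right_cancel₀ (mul_ne_zero h3 h4')
    simp only [Nat.reduceAdd, Nat.cast_one]
    linear_combination (2 * l + 3) / 2 * r1 + (l + 2) * coulombCoeff (l + 1) η 1 * hc +
      (1 + α ^ 2) * b1 - α / 2 * r0 - (1 + (2 * l + 3) * coulombCoeff l η 2) * hαη
  | more k ih0 ih1 =>
    have rb := coulombCoeff_recurrence hl' η k
    have ra2 := coulombCoeff_recurrence hl η (k + 2)
    have ra1 := coulombCoeff_recurrence hl η (k + 1)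
    have hk2 : (k : ℝ) + 2 ≠ 0 := by positivity
    apply mul_right_cancel₀ (mul_ne_zero hk2 (coulombCoeff_denom_ne_zero hl' k))
    simp only [add_assoc, Nat.reduceAdd, Nat.cast_add, Nat.cast_one, Nat.cast_ofNat]
      at ih0 ih1 rb ra2 ra1 ⊢
    linear_combination (k + 2) * ra2 + c * rb + 2 * η * ih1 - ih0 - α * ra1 +
      2 * coulombCoeff l η (k + 3) * hαη

theorem coulomb_ode {l : ℝ} (hl1 : l ≠ -1) (hl : ∀ n : ℕ, 2 * l + 2 ≠ -(n : ℝ)) (η x : ℝ) :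
    x * powerSum (derivCoeff (derivCoeff (coulombCoeff l η))) x +
      (2 * l + 2) * powerSum (derivCoeff (coulombCoeff l η)) x +
      (x - 2 * η) * powerSum (coulombCoeff l η) x = 0 := by
  have h0 := summable_coulombCoeff l η
  have h1 := summable_derivCoeff h0
  have h2 := summable_derivCoeff h1
  have e0 := mul_powerSum h0 x
  have e2 := mul_powerSum h2 x
  have s0 := (hasSum_nat_add_iff' 1).2 (h0 x).hasSum
  have s1 := (hasSum_nat_add_iff' 1).2 (h1 x).hasSum
  have hs := (e2.add (s1.mul_left (2 * l + 2))).add (e0.sub (s0.mul_left (2 * η)))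
  have hz := hs.congr_fun (g := fun _ => 0) fun k => by
    have hr := coulombCoeff_recurrence hl η k
    simp only [derivCoeff]
    push_cast
    linear_combination (-x ^ (k + 1)) * hr
  have hv := hz.unique hasSum_zero
  have hl' : l + 1 ≠ 0 := fun h => hl1 (by linarith)
  have ha1 : (2 * l + 2) * coulombCoeff l η 1 = 2 * η := by
    rw [coulombCoeff]
    field_simp
  have ha0 : coulombCoeff l η 0 = 1 := by rw [coulombCoeff]
  simp only [Finset.sum_range_one, pow_zero, derivCoeff] at hv
  norm_num [ha0] at hv
  simp only [powerSum, derivCoeff] at hv ⊢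
  linear_combination hv + ha1

theorem powerSum_derivCoeff_coulombCoeff {l : ℝ} (hl1 : l ≠ -1)
    (hl : ∀ n : ℕ, 2 * l + 2 ≠ -(n : ℝ)) (η x : ℝ) :
    powerSum (derivCoeff (coulombCoeff l η)) x = η / (l + 1) * coulombPhi l η x -
      ((l + 1) ^ 2 + η ^ 2) / ((l + 1) ^ 2 * (2 * l + 3)) * (x * coulombPhi (l + 1) η x) := by
  have h0 := summable_coulombCoeff l η
  have s0 := (hasSum_nat_add_iff' 1).2 (h0 x).hasSum
  have s1 := (hasSum_nat_add_iff' 1).2 (summable_derivCoeff h0 x).hasSum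
  have e := mul_powerSum (summable_coulombCoeff (l + 1) η) x
  have hs := (s0.mul_left (η / (l + 1))).sub
    (e.mul_left (((l + 1) ^ 2 + η ^ 2) / ((l + 1) ^ 2 * (2 * l + 3))))
  have hs' := hs.congr_fun (g := fun k => derivCoeff (coulombCoeff l η) (k + 1) * x ^ (k + 1))
    fun k => by
      have hr := coulombCoeff_contiguous hl1 hl η k
      simp only [derivCoeff]
      push_cast
      linear_combination x ^ (k + 1) * hr
  have hv := s1.unique hs'
  have ha1 : coulombCoeff l η 1 = η / (l + 1) := by rw [coulombCoeff]
  have ha0 : coulombCoeff l η 0 = 1 := by rw [coulombCoeff]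
  simp only [Finset.sum_range_one, pow_zero, derivCoeff] at hv
  norm_num [ha0, ha1] at hv
  simp only [powerSum, derivCoeff, coulombPhi] at hv ⊢
  linear_combination hv

/-- Lemma 3.1, second part: φ_{ℓ,η} and φ_{ℓ+1,η} have no nonzero real zero in common,
and neither vanishes at the origin where both equal 1. -/
theorem stmt_6 (l η : ℝ) (hl1 : l ≠ -1) (hη : η ≠ 0)
    (hl2 : ∀ n : ℕ, 2 * l + 2 ≠ -(n : ℝ)) :
    (∀ x : ℝ, x ≠ 0 → ¬(coulombPhi l η x = 0 ∧ coulombPhi (l + 1) η x = 0)) ∧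
      coulombPhi l η 0 = 1 ∧ coulombPhi (l + 1) η 0 = 1 := by
  refine ⟨?_, ?_, ?_⟩
  · rintro x hx ⟨hφ, hφ'⟩
    have h0 := summable_coulombCoeff l η
    have h1 := summable_derivCoeff h0
    have hd := powerSum_derivCoeff_coulombCoeff hl1 hl2 η x
    rw [hφ, hφ'] at hd
    have hscale : ∀ {c : ℕ → ℝ}, (∀ y : ℝ, Summable fun k => c k * y ^ k) → ∀ t : ℝ,
        HasDerivAt (fun t => powerSum c (x * t)) (x * powerSum (derivCoeff c) (x * t)) t := by
      intro c hc t
      have hm : HasDerivAt (fun t : ℝ => x * t) x t := by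
        simpa using (hasDerivAt_id t).const_mul x
      refine ((hasDerivAt_powerSum hc (x * t)).comp t hm).congr_deriv ?_
      ring
    have hf0 := eq_zero_of_singular_ode (a := 2 * l + 2) (b := x ^ 2) (d := -2 * η * x)
      (hscale h0) (fun t => (hscale h1 t).const_mul x)
      (fun t => by linear_combination x * coulomb_ode hl1 hl2 η (x * t))
      (by simpa [powerSum, coulombPhi] using hφ) (by simpa using Or.inr hd)
    rw [mul_zero, powerSum_zero, coulombCoeff] at hf0
    exact one_ne_zero hf0
  · exact (powerSum_zero _).trans (by rw [coulombCoeff])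
  · exact (powerSum_zero _).trans (by rw [coulombCoeff])
end

section
/- Fix ℓ > −1/2 and k ∈ ℕ. Then the k-th positive zero of the regular Coulomb wave function is strictly increasing in η on ℝ: if η₁ < η₂, then ρ_{ℓ,η₁,k} < ρ_{ℓ,η₂,k}. -/
/-- `ρ : ℕ → ℝ` enumerates all the positive zeros of `f` in (strictly) increasing order,
`ρ k` being the (k+1)-st positive zero. -/
def IsPosZeroEnum (f : ℝ → ℝ) (ρ : ℕ → ℝ) : Prop :=
  StrictMono ρ ∧ (∀ k, 0 < ρ k ∧ f (ρ k) = 0) ∧ ∀ x, 0 < x → f x = 0 → ∃ k, ρ k = x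

section PowerSeries

variable {c : ℕ → ℝ} {C M : ℝ}

/-- Coefficients dominated by those of `C * exp (M x)` give an everywhere convergent series. -/
lemma summable_mul_pow_of_abs_le (hc : ∀ k, |c k| ≤ C * (M ^ k / k.factorial)) (x : ℝ) :
    Summable fun k => c k * x ^ k := by
  refine Summable.of_norm_bounded
    ((Real.summable_pow_div_factorial (M * |x|)).mul_left C) fun k => ?_
  rw [Real.norm_eq_abs, abs_mul, abs_pow, mul_pow]
  calc |c k| * |x| ^ k ≤ C * (M ^ k / k.factorial) * |x| ^ k := by gcongr; exact hc k
    _ = _ := by ring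

/-- The coefficients of the derived series satisfy the same kind of bound. -/
lemma abs_succ_mul_le_of_abs_le (hc : ∀ k, |c k| ≤ C * (M ^ k / k.factorial)) (k : ℕ) :
    |((k : ℝ) + 1) * c (k + 1)| ≤ (C * M) * (M ^ k / k.factorial) := by
  have hk : (0 : ℝ) < (k : ℝ) + 1 := by positivity
  rw [abs_mul, abs_of_pos hk]
  calc ((k : ℝ) + 1) * |c (k + 1)|
      ≤ ((k : ℝ) + 1) * (C * (M ^ (k + 1) / (k + 1).factorial)) := by gcongr; exact hc _
    _ = _ := by
      rw [Nat.factorial_succ]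
      push_cast
      have : (k.factorial : ℝ) ≠ 0 := by positivity
      field_simp
      ring

/-- Termwise differentiation of a power series with exponentially bounded coefficients. -/
lemma hasDerivAt_tsum_mul_pow (hc : ∀ k, |c k| ≤ C * (M ^ k / k.factorial)) (x : ℝ) :
    HasDerivAt (fun y => ∑' k, c k * y ^ k) (∑' k : ℕ, (((k : ℝ) + 1) * c (k + 1)) * x ^ k) x := by
  set R := |x| + 1
  have hd := abs_succ_mul_le_of_abs_le hc
  have hd' : ∀ k : ℕ, |(|((k : ℝ) + 1) * c (k + 1)|)| ≤ (C * M) * (M ^ k / k.factorial) := by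
    simpa only [abs_abs] using hd
  have hu : Summable fun k : ℕ => |c k| * (k * R ^ (k - 1)) := by
    rw [← summable_nat_add_iff 1]
    refine (summable_mul_pow_of_abs_le hd' R).congr fun k => ?_
    rw [abs_mul, abs_of_nonneg (by positivity : (0 : ℝ) ≤ (k : ℝ) + 1)]
    push_cast
    ring
  have key := hasDerivAt_tsum_of_isPreconnected (t := Metric.ball (0 : ℝ) R)
    (g := fun k y => c k * y ^ k) (g' := fun k y => c k * (k * y ^ (k - 1))) (y₀ := 0) (y := x)
    hu Metric.isOpen_ball (convex_ball 0 R).isPreconnected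
    (fun k y _ => (hasDerivAt_pow k y).const_mul (c k))
    (fun k y hy => by
      have hy' : |y| ≤ R := by simpa using (Metric.mem_ball.mp hy).le
      rw [Real.norm_eq_abs, abs_mul, abs_mul, abs_pow, Nat.abs_cast]
      gcongr)
    (Metric.mem_ball_self (by positivity))
    (summable_mul_pow_of_abs_le hc 0)
    (by simp [R])
  refine key.congr_deriv ?_
  have hs : Summable fun k : ℕ => c k * (k * x ^ (k - 1)) := by
    rw [← summable_nat_add_iff 1]
    refine (summable_mul_pow_of_abs_le hd x).congr fun k => ?_
    push_cast
    ring
  rw [hs.tsum_eq_zero_add]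
  simp only [Nat.cast_zero, zero_mul, mul_zero, zero_add]
  refine tsum_congr fun k => ?_
  push_cast
  ring

end PowerSeries

lemma abs_coulombCoeff_le {l : ℝ} (hl : -1/2 < l) (η : ℝ) (k : ℕ) :
    |coulombCoeff l η k| ≤ 1 * ((2 * |η| + 1) ^ k / k.factorial) := by
  rw [one_mul]
  have hη := abs_nonneg η
  set M := 2 * |η| + 1 with hM
  have hM1 : 1 ≤ M := by linarith
  induction k using Nat.strong_induction_on with
  | _ k ih =>
    match k, ih with
    | 0, _ => simp [coulombCoeff]
    | 1, _ =>
      have h1 : 0 < l + 1 := by linarith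
      simp only [coulombCoeff, pow_one, Nat.factorial_one, Nat.cast_one, div_one]
      rw [abs_div, abs_of_pos h1, div_le_iff₀ h1]
      nlinarith
    | k + 2, ih =>
      have h0 := ih k (by omega)
      have h1 := ih (k + 1) (by omega)
      have hk : (0 : ℝ) ≤ k := by positivity
      have hD : ((k : ℝ) + 2) * ((k : ℝ) + 2) ≤ ((k : ℝ) + 2) * (((k : ℝ) + 2) + 2 * l + 1) :=
        mul_le_mul_of_nonneg_left (by linarith) (by linarith)
      have hD0 : 0 < ((k : ℝ) + 2) * (((k : ℝ) + 2) + 2 * l + 1) := by nlinarith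
      have hf : (0 : ℝ) < k.factorial := by positivity
      have hMk : 0 < M ^ k := by positivity
      simp only [coulombCoeff]
      rw [abs_div, abs_of_pos hD0, div_le_iff₀ hD0]
      calc |2 * η * coulombCoeff l η (k + 1) - coulombCoeff l η k|
          ≤ |2 * η * coulombCoeff l η (k + 1)| + |coulombCoeff l η k| := abs_sub _ _
        _ ≤ M * (M ^ (k + 1) / (k + 1).factorial) + M ^ k / k.factorial := by
            rw [abs_mul, abs_mul, abs_two]
            gcongr
            linarith
        _ ≤ M ^ (k + 2) / (k + 2).factorial * (((k : ℝ) + 2) * ((k : ℝ) + 2)) := by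
            rw [Nat.factorial_succ (k + 1), Nat.factorial_succ k]
            push_cast
            have hM2 : M ^ k ≤ M ^ (k + 2) := pow_le_pow_right₀ hM1 (by omega)
            have e : M ^ (k + 2) / (((k : ℝ) + 1 + 1) * (((k : ℝ) + 1) * k.factorial))
                * (((k : ℝ) + 2) * ((k : ℝ) + 2))
                - M * (M ^ (k + 1) / (((k : ℝ) + 1) * k.factorial))
                = M ^ (k + 2) / k.factorial := by
              field_simp
              ring
            have : M ^ k / k.factorial ≤ M ^ (k + 2) / (k.factorial : ℝ) := by gcongr
            linarith
        _ ≤ _ := by gcongr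

/-- `f`, with derivative `f'`, solves the equation `x f'' + 2 (l + 1) f' + (x - 2 η) f = 0`
satisfied by `coulombPhi l η`. -/
structure IsCoulombSolution (l η : ℝ) (f f' : ℝ → ℝ) : Prop where
  hasDerivAt : ∀ x, HasDerivAt f (f' x) x
  exists_hasDerivAt : ∀ x, ∃ f'' : ℝ, HasDerivAt f' f'' x ∧
    x * f'' + 2 * (l + 1) * f' x + (x - 2 * η) * f x = 0

namespace IsCoulombSolution

variable {l η η₁ η₂ : ℝ} {f f' g g' : ℝ → ℝ}

lemma neg (hf : IsCoulombSolution l η f f') : IsCoulombSolution l η (-f) (-f') where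
  hasDerivAt x := (hf.hasDerivAt x).neg
  exists_hasDerivAt x := by
    obtain ⟨f'', h, e⟩ := hf.exists_hasDerivAt x
    refine ⟨-f'', h.neg, ?_⟩
    simp only [Pi.neg_apply]
    linarith

lemma continuous (hf : IsCoulombSolution l η f f') : Continuous f :=
  continuous_iff_continuousAt.mpr fun x => (hf.hasDerivAt x).continuousAt

lemma continuous_deriv (hf : IsCoulombSolution l η f f') : Continuous f' :=
  continuous_iff_continuousAt.mpr fun x =>
    (hf.exists_hasDerivAt x).elim fun _ h => h.1.continuousAt

/-- Derivative of the weighted Wronskian of two solutions with different parameters. -/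
lemma hasDerivAt_wronskian (hf : IsCoulombSolution l η₁ f f') (hg : IsCoulombSolution l η₂ g g')
    {x : ℝ} (hx : 0 < x) :
    HasDerivAt (fun y => y ^ (2 * l + 2) * (f' y * g y - f y * g' y))
      (-(2 * (η₂ - η₁) * x ^ (2 * l + 1) * (f x * g x))) x := by
  obtain ⟨f'', hf'', ef⟩ := hf.exists_hasDerivAt x
  obtain ⟨g'', hg'', eg⟩ := hg.exists_hasDerivAt x
  have hp := Real.hasDerivAt_rpow_const (x := x) (p := 2 * l + 2) (Or.inl hx.ne')
  have hW := hp.mul ((hf''.mul (hg.hasDerivAt x)).sub ((hf.hasDerivAt x).mul hg''))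
  refine hW.congr_deriv ?_
  have e1 : x ^ (2 * l + 2) = x ^ (2 * l + 1) * x := by
    rw [← Real.rpow_add_one hx.ne']
    ring_nf
  rw [show 2 * l + 2 - 1 = 2 * l + 1 by ring, e1]
  simp only [Pi.mul_apply, Pi.sub_apply]
  linear_combination x ^ (2 * l + 1) * (g x * ef - f x * eg)

end IsCoulombSolution

/-- A function vanishing at `a` and positive to the right of `a` has nonnegative derivative. -/
lemma HasDerivAt.nonneg_of_pos_right {g : ℝ → ℝ} {d a b : ℝ} (hg : HasDerivAt g d a)
    (hab : a < b) (h0 : g a = 0) (hpos : ∀ x ∈ Set.Ioo a b, 0 < g x) : 0 ≤ d := by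
  have h := (hasDerivWithinAt_iff_tendsto_slope' (s := Set.Ioi a) (by simp)).mp
    hg.hasDerivWithinAt
  refine ge_of_tendsto h ?_
  filter_upwards [Ioo_mem_nhdsGT hab] with x hx
  rw [slope_def_field, h0, sub_zero]
  exact div_nonneg (hpos x hx).le (sub_nonneg.mpr hx.1.le)

/-- A function vanishing at `b` and positive to the left of `b` has nonpositive derivative. -/
lemma HasDerivAt.nonpos_of_pos_left {g : ℝ → ℝ} {d a b : ℝ} (hg : HasDerivAt g d b)
    (hab : a < b) (h0 : g b = 0) (hpos : ∀ x ∈ Set.Ioo a b, 0 < g x) : d ≤ 0 := by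
  have h := (hasDerivWithinAt_iff_tendsto_slope' (s := Set.Iio b) (by simp)).mp
    hg.hasDerivWithinAt
  refine le_of_tendsto h ?_
  filter_upwards [Ioo_mem_nhdsLT hab] with x hx
  rw [slope_def_field, h0, sub_zero]
  exact div_nonpos_of_nonneg_of_nonpos (hpos x hx).le (sub_nonpos.mpr hx.2.le)

/-- A continuous function without zeros on an open interval has constant sign there. -/
lemma Continuous.pos_or_neg_of_ne_zero {f : ℝ → ℝ} (hf : Continuous f) {a b : ℝ}
    (h : ∀ x ∈ Set.Ioo a b, f x ≠ 0) :
    (∀ x ∈ Set.Ioo a b, 0 < f x) ∨ ∀ x ∈ Set.Ioo a b, f x < 0 := by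
  by_contra! hcon
  obtain ⟨⟨x, hx, hfx⟩, y, hy, hfy⟩ := hcon
  obtain ⟨z, hz, hfz⟩ := isPreconnected_Ioo.intermediate_value hx hy hf.continuousOn ⟨hfx, hfy⟩
  exact h z hz hfz

namespace IsCoulombSolution

variable {l η₁ η₂ : ℝ} {f f' g g' : ℝ → ℝ}

lemma not_pos_of_pos (hl : -1/2 < l) (hη : η₁ < η₂) (hf : IsCoulombSolution l η₁ f f')
    (hg : IsCoulombSolution l η₂ g g') {a b : ℝ} (ha : 0 ≤ a) (hab : a < b)
    (hga : a = 0 ∨ g a = 0) (hgb : g b = 0) (hgpos : ∀ x ∈ Set.Ioo a b, 0 < g x) :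
    ¬ ∀ x ∈ Set.Ioo a b, 0 < f x := by
  intro hfpos
  have hb : 0 < b := ha.trans_lt hab
  have hfnonneg : ∀ x ∈ Set.Icc a b, 0 ≤ f x := by
    intro x hx
    rw [← closure_Ioo hab.ne] at hx
    exact le_on_closure (fun y hy => (hfpos y hy).le) continuousOn_const
      hf.continuous.continuousOn hx
  set W : ℝ → ℝ := fun y => y ^ (2 * l + 2) * (f' y * g y - f y * g' y) with hW
  have hcont : Continuous W :=
    (Real.continuous_rpow_const (by linarith)).mul
      ((hf.continuous_deriv.mul hg.continuous).sub (hf.continuous.mul hg.continuous_deriv))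
  have hanti : StrictAntiOn W (Set.Icc a b) := by
    refine strictAntiOn_of_deriv_neg (convex_Icc a b) hcont.continuousOn fun x hx => ?_
    rw [interior_Icc] at hx
    have hx0 : 0 < x := ha.trans_lt hx.1
    rw [(hf.hasDerivAt_wronskian hg hx0).deriv, neg_neg_iff_pos]
    have := hfpos x hx
    have := hgpos x hx
    have := sub_pos.mpr hη
    positivity
  have hlt := hanti (Set.left_mem_Icc.mpr hab.le) (Set.right_mem_Icc.mpr hab.le) hab
  have hWa : W a ≤ 0 := by
    rcases hga with rfl | hga
    · simp [hW, Real.zero_rpow (by linarith : 2 * l + 2 ≠ 0)]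
    · have h1 := (hg.hasDerivAt a).nonneg_of_pos_right hab hga hgpos
      have h2 := hfnonneg a (Set.left_mem_Icc.mpr hab.le)
      simp only [hW, hga, mul_zero, zero_sub]
      exact mul_nonpos_of_nonneg_of_nonpos (by positivity) (by nlinarith)
  have hWb : 0 ≤ W b := by
    have h1 := (hg.hasDerivAt b).nonpos_of_pos_left hab hgb hgpos
    have h2 := hfnonneg b (Set.right_mem_Icc.mpr hab.le)
    simp only [hW, hgb, mul_zero, zero_sub]
    exact mul_nonneg (by positivity) (by nlinarith)
  linarith

/-- Sturm comparison: strictly between consecutive zeros of a solution with parameter `η₂`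
(the singular point `0` counting as a zero) every solution with parameter `η₁ < η₂` vanishes. -/
lemma exists_zero (hl : -1/2 < l) (hη : η₁ < η₂) (hf : IsCoulombSolution l η₁ f f')
    (hg : IsCoulombSolution l η₂ g g') {a b : ℝ} (ha : 0 ≤ a) (hab : a < b)
    (hga : a = 0 ∨ g a = 0) (hgb : g b = 0) (hgne : ∀ x ∈ Set.Ioo a b, g x ≠ 0) :
    ∃ x ∈ Set.Ioo a b, f x = 0 := by
  by_contra! hfne
  have hga' : a = 0 ∨ (-g) a = 0 := by simpa using hga
  have hgb' : (-g) b = 0 := by simpa using hgb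
  rcases hg.continuous.pos_or_neg_of_ne_zero hgne with hgs | hgs <;>
    rcases hf.continuous.pos_or_neg_of_ne_zero hfne with hfs | hfs
  · exact not_pos_of_pos hl hη hf hg ha hab hga hgb hgs hfs
  · exact not_pos_of_pos hl hη hf.neg hg ha hab hga hgb hgs
      fun x hx => neg_pos.mpr (hfs x hx)
  · exact not_pos_of_pos hl hη hf hg.neg ha hab hga' hgb'
      (fun x hx => neg_pos.mpr (hgs x hx)) hfs
  · exact not_pos_of_pos hl hη hf.neg hg.neg ha hab hga' hgb'
      (fun x hx => neg_pos.mpr (hgs x hx)) fun x hx => neg_pos.mpr (hfs x hx)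

end IsCoulombSolution

lemma isCoulombSolution_coulombPhi {l : ℝ} (hl : -1/2 < l) (η : ℝ) :
    IsCoulombSolution l η (coulombPhi l η)
      (fun x => ∑' k : ℕ, (((k : ℝ) + 1) * coulombCoeff l η (k + 1)) * x ^ k) where
  hasDerivAt := hasDerivAt_tsum_mul_pow (abs_coulombCoeff_le hl η)
  exists_hasDerivAt x := by
    have ha := abs_coulombCoeff_le hl η
    have ha' := abs_succ_mul_le_of_abs_le ha
    have ha'' := abs_succ_mul_le_of_abs_le ha'
    refine ⟨_, hasDerivAt_tsum_mul_pow ha' x, ?_⟩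
    have s0 := summable_mul_pow_of_abs_le ha x
    have s1 := summable_mul_pow_of_abs_le ha' x
    have s2 := summable_mul_pow_of_abs_le ha'' x
    have s0' := (summable_nat_add_iff 1).mpr s0
    have s1' := (summable_nat_add_iff 1).mpr s1
    have hsum := (((s2.hasSum.mul_left x).add (s1'.hasSum.mul_left (2 * (l + 1)))).add
      (s0.hasSum.mul_left x)).sub (s0'.hasSum.mul_left (2 * η))
    have hzero := hsum.unique (by
      convert hasSum_zero using 2 with k
      simp only [coulombCoeff, pow_succ]
      have h1 : (k : ℝ) + 2 + 2 * l + 1 ≠ 0 := by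
        have : (0 : ℝ) ≤ k := by positivity
        linarith
      push_cast
      field_simp
      ring)
    rw [s1.tsum_eq_zero_add, coulombPhi]
    have e0 : ∑' k, coulombCoeff l η k * x ^ k
        = 1 + ∑' k, coulombCoeff l η (k + 1) * x ^ (k + 1) := by
      rw [s0.tsum_eq_zero_add]
      simp [coulombCoeff]
    have e1 : 2 * (l + 1) * coulombCoeff l η 1 = 2 * η := by
      have : l + 1 ≠ 0 := by linarith
      simp only [coulombCoeff]
      field_simp
    simp only [Nat.cast_zero, zero_add, one_mul, pow_zero, mul_one]
    linear_combination hzero + e1 - 2 * η * e0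

/-- Theorem 4.2: for fixed ℓ > −1/2 and k, the k-th positive zero of F_{ℓ,η} (equivalently
of φ_{ℓ,η}) is strictly increasing in η on ℝ. -/
theorem stmt_10 (l : ℝ) (hl : -1/2 < l) (k : ℕ) (η₁ η₂ : ℝ) (h : η₁ < η₂) :
    ∀ ρ₁ ρ₂ : ℕ → ℝ, IsPosZeroEnum (coulombPhi l η₁) ρ₁ →
      IsPosZeroEnum (coulombPhi l η₂) ρ₂ → ρ₁ k < ρ₂ k := by
  intro ρ₁ ρ₂ ⟨hm₁, _, hall₁⟩ ⟨hm₂, hz₂, hall₂⟩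
  have hf := isCoulombSolution_coulombPhi hl η₁
  have hg := isCoulombSolution_coulombPhi hl η₂
  induction k with
  | zero =>
    obtain ⟨x, hx, hx0⟩ := hf.exists_zero hl h hg le_rfl (hz₂ 0).1 (Or.inl rfl) (hz₂ 0).2
      fun x hx hx0 => by
        obtain ⟨j, rfl⟩ := hall₂ x hx.1 hx0
        exact absurd (hm₂.lt_iff_lt.mp hx.2) (Nat.not_lt_zero j)
    obtain ⟨j, rfl⟩ := hall₁ x hx.1 hx0
    exact (hm₁.monotone (Nat.zero_le j)).trans_lt hx.2
  | succ k ih =>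
    obtain ⟨x, hx, hx0⟩ := hf.exists_zero hl h hg (hz₂ k).1.le (hm₂ k.lt_succ_self)
      (Or.inr (hz₂ k).2) (hz₂ (k + 1)).2 fun x hx hx0 => by
        obtain ⟨j, rfl⟩ := hall₂ x ((hz₂ k).1.trans hx.1) hx0
        have h1 := hm₂.lt_iff_lt.mp hx.1
        have h2 := hm₂.lt_iff_lt.mp hx.2
        omega
    obtain ⟨j, rfl⟩ := hall₁ x ((hz₂ k).1.trans hx.1) hx0
    have hkj : k < j := hm₁.lt_iff_lt.mp (ih.trans hx.1)
    exact (hm₁.monotone hkj).trans_lt hx.2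
end
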